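/- Let d ≥ 1, let T be a measure preserving ℤ^d-action on a σ-finite standard measure space (X, μ), and let T̃ be the induced ℝ^d-action on ([0,1)^d × X, Leb × μ). Then a line θ ∈ P(ℝ^d) is a recurrent direction for T if and only if θ is a recurrent direction for T̃; that is, 𝓡(T) = 𝓡(T̃). -/

import Mathlib

open MeasureTheory Filter Set Topology

noncomputable section

instance {d : ℕ} : TopologicalSpace (Projectivization ℝ (Fin d → ℝ)) :=
  inferInstanceAs (TopologicalSpace (Quotient _))

/-- The coordinatewise cast of an integer vector to a real vector. -/
def zcast {d : ℕ} (γ : Fin d → ℤ) : Fin d → ℝ := fun i => (γ i : ℝ)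

/-- `T` is a measure preserving `ℤ^d`-action on `(X, μ)`. -/
def IsMPAction {d : ℕ} {X : Type*} [MeasurableSpace X] (μ : Measure X)
    (T : (Fin d → ℤ) → X ≃ᵐ X) : Prop :=
  (∀ γ γ' : Fin d → ℤ, ∀ x : X, T (γ + γ') x = T γ (T γ' x)) ∧
    ∀ γ : Fin d → ℤ, MeasurePreserving (T γ) μ μ

/-- The action `T` is free. -/
def IsFreeAction {d : ℕ} {X : Type*} [MeasurableSpace X] (μ : Measure X)
    (T : (Fin d → ℤ) → X ≃ᵐ X) : Prop :=
  ∀ γ : Fin d → ℤ, γ ≠ 0 → ∀ᵐ x ∂μ, T γ x ≠ x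

/-- `T` is recurrent along the line `θ ∈ P(ℝ^d)`. -/
def RecurrentAlong {d : ℕ} {X : Type*} [MeasurableSpace X] (μ : Measure X)
    (T : (Fin d → ℤ) → X ≃ᵐ X) (θ : Projectivization ℝ (Fin d → ℝ)) : Prop :=
  ∀ ε : ℝ, 0 < ε → ∀ A : Set X, MeasurableSet A → 0 < μ A →
    ∃ γ : Fin d → ℤ, γ ≠ 0 ∧ ∃ v ∈ θ.submodule, ‖zcast γ - v‖ < ε ∧ 0 < μ (A ∩ T γ '' A)

/-- The set of recurrent directions `𝓡(T)`. -/
def recSet {d : ℕ} {X : Type*} [MeasurableSpace X] (μ : Measure X)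
    (T : (Fin d → ℤ) → X ≃ᵐ X) : Set (Projectivization ℝ (Fin d → ℝ)) :=
  {θ | RecurrentAlong μ T θ}

/-- `T` is rigid along the line `θ ∈ P(ℝ^d)`. -/
def RigidAlong {d : ℕ} {X : Type*} [MeasurableSpace X] (μ : Measure X)
    (T : (Fin d → ℤ) → X ≃ᵐ X) (θ : Projectivization ℝ (Fin d → ℝ)) : Prop :=
  ∃ γ : ℕ → Fin d → ℤ,
    Tendsto (fun n => ‖zcast (γ n)‖) atTop atTop ∧
    Tendsto (fun n => Metric.infDist (zcast (γ n)) ((θ.submodule : Set (Fin d → ℝ)))) atTop (𝓝 0) ∧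
    ∀ A : Set X, MeasurableSet A → μ A < ⊤ →
      Tendsto (fun n => μ (A ∩ T (γ n) '' A)) atTop (𝓝 (μ A))

/-- The set of rigid directions `𝓡i(T)`. -/
def rigSet {d : ℕ} {X : Type*} [MeasurableSpace X] (μ : Measure X)
    (T : (Fin d → ℤ) → X ≃ᵐ X) : Set (Projectivization ℝ (Fin d → ℝ)) :=
  {θ | RigidAlong μ T θ}

/-- The measure `Leb × μ` on `[0,1)^d × X`. -/
def indMeasure {d : ℕ} {X : Type*} [MeasurableSpace X] (μ : Measure X) :
    Measure ((Fin d → ℝ) × X) :=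
  (Measure.pi fun _ : Fin d => (volume : Measure ℝ).restrict (Set.Ico 0 1)).prod μ

/-- The induced `ℝ^d`-action `T̃_t(y, x) = ({t+y}, T_{[t+y]} x)`. -/
def indMap {d : ℕ} {X : Type*} [MeasurableSpace X] (T : (Fin d → ℤ) → X ≃ᵐ X)
    (t : Fin d → ℝ) : (Fin d → ℝ) × X → (Fin d → ℝ) × X :=
  fun p => (fun i => Int.fract (t i + p.1 i), T (fun i => ⌊t i + p.1 i⌋) p.2)

/-- A one-parameter flow `F` on `(Y, ν)` is conservative. -/
def FlowConservative {Y : Type*} [MeasurableSpace Y] (ν : Measure Y) (F : ℝ → Y → Y) : Prop :=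
  ∀ B : Set Y, MeasurableSet B → 0 < ν B → ∀ K : Set ℝ, IsCompact K →
    ∃ s : ℝ, s ∉ K ∧ 0 < ν (B ∩ F s '' B)

/-- A one-parameter flow `F` on `(Y, ν)` is rigid. -/
def FlowRigid {Y : Type*} [MeasurableSpace Y] (ν : Measure Y) (F : ℝ → Y → Y) : Prop :=
  ∃ s : ℕ → ℝ, Tendsto s atTop atTop ∧
    ∀ B : Set Y, MeasurableSet B → ν B < ⊤ →
      Tendsto (fun n => ν (B ∩ F (s n) '' B)) atTop (𝓝 (ν B))

/-- An `ℝ^d`-action `R` on `(Y, ν)` is recurrent along the line `θ`: the flow along some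
(equivalently, every) nonzero vector of `θ` is conservative. -/
def ActionRecurrentAlong {d : ℕ} {Y : Type*} [MeasurableSpace Y] (ν : Measure Y)
    (R : (Fin d → ℝ) → Y → Y) (θ : Projectivization ℝ (Fin d → ℝ)) : Prop :=
  ∃ v ∈ θ.submodule, v ≠ (0 : Fin d → ℝ) ∧ FlowConservative ν (fun s => R (s • v))

/-- An `ℝ^d`-action `R` on `(Y, ν)` is rigid along the line `θ`. -/
def ActionRigidAlong {d : ℕ} {Y : Type*} [MeasurableSpace Y] (ν : Measure Y)
    (R : (Fin d → ℝ) → Y → Y) (θ : Projectivization ℝ (Fin d → ℝ)) : Prop :=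
  ∃ v ∈ θ.submodule, v ≠ (0 : Fin d → ℝ) ∧ FlowRigid ν (fun s => R (s • v))

open Metric

lemma one_le_norm_zcast {d : ℕ} {γ : Fin d → ℤ} (hγ : γ ≠ 0) : 1 ≤ ‖zcast γ‖ := by
  obtain ⟨i, hi⟩ := Function.ne_iff.1 hγ
  refine le_trans ?_ (norm_le_pi_norm (zcast γ) i)
  simp only [zcast, Real.norm_eq_abs]
  exact_mod_cast Int.one_le_abs hi

lemma zcast_zero {d : ℕ} : zcast (0 : Fin d → ℤ) = 0 := by
  ext i; simp [zcast]

lemma zcast_add {d : ℕ} (γ γ' : Fin d → ℤ) : zcast (γ + γ') = zcast γ + zcast γ' := by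
  ext i; simp [zcast]

lemma zcast_neg {d : ℕ} (γ : Fin d → ℤ) : zcast (-γ) = -zcast γ := by
  ext i; simp [zcast]

namespace IsMPAction

variable {d : ℕ} {X : Type*} [MeasurableSpace X] {μ : Measure X} {T : (Fin d → ℤ) → X ≃ᵐ X}

lemma apply_zero (hT : IsMPAction μ T) (x : X) : T 0 x = x :=
  (T 0).injective (by rw [← hT.1, add_zero])

lemma neg_apply_apply (hT : IsMPAction μ T) (γ : Fin d → ℤ) (x : X) : T (-γ) (T γ x) = x := by
  rw [← hT.1, neg_add_cancel, hT.apply_zero]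

lemma image_eq_preimage (hT : IsMPAction μ T) (γ : Fin d → ℤ) (A : Set X) :
    T γ '' A = T (-γ) ⁻¹' A := by
  ext x
  constructor
  · rintro ⟨y, hy, rfl⟩
    simpa [hT.neg_apply_apply] using hy
  · intro hx
    exact ⟨T (-γ) x, hx, by simpa using hT.neg_apply_apply (-γ) x⟩

lemma measure_inter_preimage (hT : IsMPAction μ T) (γ : Fin d → ℤ) (A : Set X) :
    μ (A ∩ T γ ⁻¹' A) = μ (A ∩ T γ '' A) := by
  rw [← (hT.2 γ).measure_preimage_equiv (A ∩ T γ '' A), preimage_inter, preimage_image_eq _ (T γ).injective,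
    inter_comm]

lemma measure_inter_image_neg (hT : IsMPAction μ T) (γ : Fin d → ℤ) (A : Set X) :
    μ (A ∩ T (-γ) '' A) = μ (A ∩ T γ '' A) := by
  rw [hT.image_eq_preimage, neg_neg, hT.measure_inter_preimage]

/-- Recurrence along the line of `v` yields returns arbitrarily far out in the direction of `v`. -/
lemma exists_far_return (hT : IsMPAction μ T) {θ : Projectivization ℝ (Fin d → ℝ)}
    (h : RecurrentAlong μ T θ) {v : Fin d → ℝ} (hv : θ.submodule = Submodule.span ℝ {v})
    (n : ℕ) {ε : ℝ} (hε : 0 < ε) {A : Set X} (hA : MeasurableSet A) (hA0 : 0 < μ A) :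
    ∃ (γ : Fin d → ℤ) (s : ℝ), n / 2 ≤ s * ‖v‖ ∧ ‖zcast γ - s • v‖ < ε ∧
      0 < μ (A ∩ T γ '' A) := by
  induction n generalizing ε A with
  | zero =>
    refine ⟨0, 0, by simp, by simpa [zcast_zero] using hε, ?_⟩
    rw [← hT.measure_inter_preimage]
    simpa [preimage, hT.apply_zero] using hA0
  | succ n ih =>
    obtain ⟨γ, s, hs, hγs, hpos⟩ := ih (half_pos hε) hA hA0
    have hA' : MeasurableSet (A ∩ T γ '' A) :=
      hA.inter ((T γ).measurableSet_image.2 hA)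
    obtain ⟨γ', t, ht, hγ't, hpos'⟩ : ∃ (γ' : Fin d → ℤ) (t : ℝ), 1 / 2 ≤ t * ‖v‖ ∧
        ‖zcast γ' - t • v‖ < ε / 2 ∧
        0 < μ ((A ∩ T γ '' A) ∩ T γ' '' (A ∩ T γ '' A)) := by
      obtain ⟨γ', hne, w, hw, hlt, hpos'⟩ :=
        h (min (ε / 2) (1 / 2)) (by positivity) _ hA' hpos
      rw [hv, Submodule.mem_span_singleton] at hw
      obtain ⟨t, rfl⟩ := hw
      have ht : 1 / 2 ≤ |t| * ‖v‖ := by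
        have h1 := one_le_norm_zcast hne
        have h2 := norm_sub_norm_le (zcast γ') (t • v)
        rw [norm_smul, Real.norm_eq_abs] at h2
        linarith [min_le_right (ε / 2) (1 / 2)]
      have hlt' := hlt.trans_le (min_le_left _ _)
      rcases le_total 0 t with h0 | h0
      · exact ⟨γ', t, by rwa [abs_of_nonneg h0] at ht, hlt', hpos'⟩
      · refine ⟨-γ', -t, by rwa [abs_of_nonpos h0] at ht, ?_, ?_⟩
        · rwa [zcast_neg, neg_smul, ← neg_sub', norm_neg]
        · rwa [hT.measure_inter_image_neg]
    refine ⟨γ' + γ, t + s, by push_cast; linarith, ?_, hpos'.trans_le (measure_mono ?_)⟩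
    · rw [zcast_add, add_smul, add_sub_add_comm]
      exact (norm_add_le _ _).trans_lt (by linarith)
    · rintro x ⟨⟨hx, -⟩, y, ⟨-, z, hz, rfl⟩, rfl⟩
      exact ⟨hx, z, hz, hT.1 _ _ _⟩

end IsMPAction

lemma exists_closedBall_measure_inter_gt {d : ℕ} {S : Set (Fin d → ℝ)} (hS : volume S ≠ 0) :
    ∃ p : ℕ × ℕ, 3 / 4 * volume (closedBall (TopologicalSpace.denseSeq (Fin d → ℝ) p.1)
        (1 / ((p.2 : ℝ) + 1))) <
      volume (S ∩ closedBall (TopologicalSpace.denseSeq (Fin d → ℝ) p.1)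
        (1 / ((p.2 : ℝ) + 1))) := by
  have : (ae (volume.restrict S)).NeBot := ae_restrict_neBot.2 hS
  obtain ⟨x, hx⟩ :=
    (IsUnifLocDoublingMeasure.ae_tendsto_measure_inter_div.{0, 0} volume S 1).exists
  have hn : ∀ m : ℕ, ∃ n, dist x (TopologicalSpace.denseSeq (Fin d → ℝ) n) < 1 / ((m : ℝ) + 1) :=
    fun m => (TopologicalSpace.denseRange_denseSeq _).exists_dist_lt x Nat.one_div_pos_of_nat
  choose n hn using hn
  have hlim := hx (fun m => TopologicalSpace.denseSeq (Fin d → ℝ) (n m))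
    (fun m : ℕ => 1 / ((m : ℝ) + 1))
    (tendsto_nhdsWithin_iff.2 ⟨tendsto_one_div_add_atTop_nhds_zero_nat,
      .of_forall fun m => mem_Ioi.2 Nat.one_div_pos_of_nat⟩)
    (.of_forall fun m => by simpa [one_div] using (hn m).le)
  have h34 : (3 / 4 : ENNReal) < 1 :=
    ENNReal.div_lt_of_lt_mul (by norm_num)
  obtain ⟨m, hm⟩ := (hlim.eventually_const_lt h34).exists
  exact ⟨(n m, m), ENNReal.mul_lt_of_lt_div hm⟩

/-- Two sets filling most of a ball still overlap after a small translation. -/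
lemma exists_forall_measure_inter_translate_pos {d : ℕ} (c : Fin d → ℝ) {r : ℝ} (hr : 0 < r) :
    ∃ ε > 0, ∀ u : Fin d → ℝ, ‖u‖ < ε → ∀ S S' : Set (Fin d → ℝ), MeasurableSet S →
      MeasurableSet S' → 3 / 4 * volume (closedBall c r) < volume (S ∩ closedBall c r) →
      3 / 4 * volume (closedBall c r) < volume (S' ∩ closedBall c r) →
      0 < volume (S ∩ (fun y => y - u) ⁻¹' S') := by
  have hlt : (2 * (r + 0)) ^ Fintype.card (Fin d) < 3 / 2 * (2 * r) ^ Fintype.card (Fin d) := by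
    rw [add_zero]
    have : 0 < (2 * r) ^ Fintype.card (Fin d) := by positivity
    linarith
  have hcont : Continuous fun e : ℝ => (2 * (r + e)) ^ Fintype.card (Fin d) := by fun_prop
  obtain ⟨ε, hε, hball⟩ := Metric.eventually_nhds_iff.1
    (hcont.continuousAt.eventually_lt_const hlt)
  refine ⟨ε, hε, fun u hu S S' hS hS' h h' => pos_iff_ne_zero.2 fun hnull => ?_⟩
  have hvol : volume (closedBall c (r + ‖u‖)) < 3 / 2 * volume (closedBall c r) := by
    rw [Real.volume_pi_closedBall _ (by positivity), Real.volume_pi_closedBall _ hr.le,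
      show (3 / 2 : ENNReal) = ENNReal.ofReal (3 / 2) by
        rw [ENNReal.ofReal_div_of_pos two_pos]; norm_num,
      ← ENNReal.ofReal_mul (by norm_num)]
    exact (ENNReal.ofReal_lt_ofReal_iff (by positivity)).2 (hball (by simpa using hu))
  set P := S ∩ closedBall c r
  set P' := (fun y => y - u) ⁻¹' (S' ∩ closedBall c r)
  have hP' : MeasurableSet P' :=
    (measurable_sub_const u) (hS'.inter isClosed_closedBall.measurableSet)
  have hvolP' : volume P' = volume (S' ∩ closedBall c r) :=
    (measurePreserving_sub_right volume u).measure_preimage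
      (hS'.inter isClosed_closedBall.measurableSet).nullMeasurableSet
  have hPP' : volume (P ∩ P') = 0 :=
    measure_mono_null (inter_subset_inter inter_subset_left
      (preimage_mono inter_subset_left)) hnull
  have hsub : P ∪ P' ⊆ closedBall c (r + ‖u‖) := by
    rintro y (hy | hy)
    · exact closedBall_subset_closedBall (by linarith [norm_nonneg u]) hy.2
    · have h1 : dist (y - u) c ≤ r := hy.2
      have h2 : dist y (y - u) = ‖u‖ := by simp
      exact mem_closedBall.2 ((dist_triangle _ (y - u) _).trans (by linarith))
  have hsum := measure_union_add_inter (μ := volume) P hP'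
  rw [hPP', add_zero, hvolP'] at hsum
  have hkey := (ENNReal.add_lt_add h h').trans_le (hsum.symm.le.trans (measure_mono hsub))
  rw [← add_mul, show (3 / 4 + 3 / 4 : ENNReal) = 3 / 2 by
    rw [← ENNReal.add_div, ENNReal.div_eq_div_iff] <;> norm_num] at hkey
  exact lt_asymm hkey hvol

lemma indMeasure_eq {d : ℕ} {X : Type*} [MeasurableSpace X] (μ : Measure X) :
    indMeasure (d := d) μ =
      ((volume : Measure (Fin d → ℝ)).restrict (univ.pi fun _ => Ico 0 1)).prod μ := by
  rw [indMeasure, volume_pi, Measure.restrict_pi_pi]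

lemma indMap_eq {d : ℕ} {X : Type*} [MeasurableSpace X] (T : (Fin d → ℤ) → X ≃ᵐ X)
    {t y y' : Fin d → ℝ} {γ : Fin d → ℤ} (hy' : y' ∈ univ.pi fun _ : Fin d => Ico (0 : ℝ) 1)
    (h : t + y = zcast γ + y') (x : X) : indMap T t (y, x) = (y', T γ x) := by
  have hi (i : Fin d) : t i + y i = γ i + y' i := congrFun h i
  have h1 (i : Fin d) : ⌊t i + y i⌋ = γ i := by
    rw [hi, Int.floor_intCast_add, Int.floor_eq_zero_iff.2 (hy' i (mem_univ i)), add_zero]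
  have h2 (i : Fin d) : Int.fract (t i + y i) = y' i := by
    rw [Int.fract, h1, hi, add_sub_cancel_left]
  simp [indMap, h1, h2]

section

variable {d : ℕ} {X : Type*} [MeasurableSpace X] {μ : Measure X} [SigmaFinite μ]
  {T : (Fin d → ℤ) → X ≃ᵐ X} {θ : Projectivization ℝ (Fin d → ℝ)}

lemma actionRecurrentAlong_of_recurrentAlong (hT : IsMPAction μ T) (h : RecurrentAlong μ T θ) :
    ActionRecurrentAlong (indMeasure μ) (indMap T) θ := by
  refine ⟨θ.rep, ?_, θ.rep_nonzero, fun B₀ hB₀ hpos₀ K hK => ?_⟩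
  · rw [θ.submodule_eq]
    exact Submodule.mem_span_singleton_self _
  set C : Set (Fin d → ℝ) := univ.pi fun _ => Ico 0 1
  have hC : MeasurableSet C := .univ_pi fun _ => measurableSet_Ico
  set B := B₀ ∩ C ×ˢ univ
  have hB : MeasurableSet B := hB₀.inter (hC.prod .univ)
  have hslice (S : Set ((Fin d → ℝ) × X)) (hS : MeasurableSet S) (hSC : S ⊆ C ×ˢ univ) :
      indMeasure μ S = ∫⁻ x, volume ((fun y => (y, x)) ⁻¹' S) ∂μ := by
    rw [indMeasure_eq, Measure.prod_apply_symm hS]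
    refine lintegral_congr fun x => ?_
    rw [Measure.restrict_apply (measurable_prodMk_right hS), inter_eq_left.2]
    exact fun y hy => (hSC hy).1
  have hpos : indMeasure μ B ≠ 0 := by
    have hnull : indMeasure μ (C ×ˢ univ : Set ((Fin d → ℝ) × X))ᶜ = 0 := by
      rw [show ((C ×ˢ univ)ᶜ : Set ((Fin d → ℝ) × X)) = Cᶜ ×ˢ univ by ext; simp,
        indMeasure_eq, Measure.prod_prod, Measure.restrict_apply hC.compl, compl_inter_self]
      simp
    rw [measure_inter_conull hnull]
    exact hpos₀.ne'
  let Q (p : ℕ × ℕ) : Set (Fin d → ℝ) :=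
    closedBall (TopologicalSpace.denseSeq (Fin d → ℝ) p.1) (1 / ((p.2 : ℝ) + 1))
  let A (p : ℕ × ℕ) : Set X :=
    {x | 3 / 4 * volume (Q p) < volume ((fun y => (y, x)) ⁻¹' B ∩ Q p)}
  have hA (p : ℕ × ℕ) : MeasurableSet (A p) := by
    have : MeasurableSet (B ∩ Q p ×ˢ univ) :=
      hB.inter (isClosed_closedBall.measurableSet.prod .univ)
    convert measurableSet_lt measurable_const
      (measurable_measure_prodMk_right (μ := (volume : Measure (Fin d → ℝ))) this) using 5
    ext y
    simp
  obtain ⟨p, hp⟩ : ∃ p, 0 < μ (A p) := by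
    refine exists_measure_pos_of_not_measure_iUnion_null fun hnull => hpos ?_
    rw [hslice B hB inter_subset_right, lintegral_eq_zero_iff
      (measurable_measure_prodMk_right hB)]
    refine measure_mono_null (fun x hx => ?_) hnull
    exact mem_iUnion.2 (exists_closedBall_measure_inter_gt hx)
  obtain ⟨ε, hε, hover⟩ := exists_forall_measure_inter_translate_pos
    (TopologicalSpace.denseSeq (Fin d → ℝ) p.1) (r := 1 / ((p.2 : ℝ) + 1)) Nat.one_div_pos_of_nat
  obtain ⟨R, hR⟩ := hK.bddAbove
  obtain ⟨n, hn⟩ := exists_nat_gt (2 * (R * ‖θ.rep‖))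
  obtain ⟨γ, s, hs, hγs, hret⟩ := hT.exists_far_return h θ.submodule_eq n hε (hA p) hp
  refine ⟨s, fun hsK => ?_, ?_⟩
  · have := mul_le_mul_of_nonneg_right (hR hsK) (norm_nonneg θ.rep)
    linarith
  set u := s • θ.rep - zcast γ
  let E : Set ((Fin d → ℝ) × X) := B ∩ (fun q => (q.1 - u, (T γ).symm q.2)) ⁻¹' B
  have hE : MeasurableSet E := hB.inter
    (((measurable_fst.sub_const u).prodMk ((T γ).symm.measurable.comp measurable_snd)) hB)
  have hEpos : indMeasure μ E ≠ 0 := by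
    rw [hslice E hE (inter_subset_left.trans inter_subset_right), Ne,
      lintegral_eq_zero_iff (measurable_measure_prodMk_right hE)]
    refine fun h0 => hret.ne' (measure_mono_null ?_ h0)
    rintro x ⟨hx, z, hz, rfl⟩
    have hslices : (fun y => (y, T γ z)) ⁻¹' E =
        (fun y => (y, T γ z)) ⁻¹' B ∩ (fun y => y - u) ⁻¹' ((fun y => (y, z)) ⁻¹' B) := by
      ext y
      simp [E]
    have hpos := hover u (by rwa [norm_sub_rev]) _ _ (measurable_prodMk_right hB)
      (measurable_prodMk_right hB) hx hz
    rw [← hslices] at hpos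
    exact hpos.ne'
  refine (pos_iff_ne_zero.2 hEpos).trans_le (measure_mono ?_)
  rintro ⟨y, x⟩ ⟨hyx, hyx'⟩
  refine ⟨hyx.1, (y - u, (T γ).symm x), hyx'.1, ?_⟩
  have := indMap_eq T (t := s • θ.rep) (y := y - u) (γ := γ) hyx.2.1
    (by simp only [u]; abel)
    ((T γ).symm x)
  simpa using this

lemma recurrentAlong_of_actionRecurrentAlong
    (h : ActionRecurrentAlong (indMeasure μ) (indMap T) θ) : RecurrentAlong μ T θ := by
  obtain ⟨v, hv, hv0, hcons⟩ := h
  intro ε hε A hA hA0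
  have hvpos : 0 < ‖v‖ := norm_pos_iff.2 hv0
  set δ := min ε 1
  have hδ : 0 < δ := by positivity
  set B : Set ((Fin d → ℝ) × X) := (univ.pi fun _ => Ico 0 δ) ×ˢ A
  have hBpos : 0 < indMeasure μ B := by
    rw [indMeasure, Measure.prod_prod, Measure.pi_pi]
    refine ENNReal.mul_pos (Finset.prod_ne_zero_iff.2 fun i _ => ?_) hA0.ne'
    rw [Measure.restrict_apply measurableSet_Ico, Ico_inter_Ico]
    simp [δ, hε]
  obtain ⟨s, hs, hpos⟩ := hcons B ((MeasurableSet.univ_pi fun _ => measurableSet_Ico).prod hA)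
    hBpos (Icc (-(δ / ‖v‖)) (δ / ‖v‖)) isCompact_Icc
  have hsv : δ < ‖s • v‖ := by
    rw [norm_smul, ← div_lt_iff₀ hvpos, Real.norm_eq_abs]
    by_contra! hle
    exact hs (abs_le.1 hle)
  by_contra! hnone
  refine hpos.ne' (measure_mono_null (t := ⋃ γ ∈ {γ : Fin d → ℤ | ‖zcast γ - s • v‖ < δ},
    univ ×ˢ (A ∩ T γ '' A)) ?_ ?_)
  · rintro q ⟨⟨hy', hx'⟩, ⟨y, x⟩, ⟨hy, hx⟩, rfl⟩
    refine mem_iUnion₂.2 ⟨fun i => ⌊(s • v) i + y i⌋, ?_, mem_univ _, hx', x, hx, rfl⟩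
    rw [mem_ofPred_eq, pi_norm_lt_iff hδ]
    intro i
    have h1 : 0 ≤ Int.fract ((s • v) i + y i) ∧ Int.fract ((s • v) i + y i) < δ := hy' i (mem_univ i)
    have h2 : 0 ≤ y i ∧ y i < δ := hy i (mem_univ i)
    rw [Int.fract] at h1
    rw [Real.norm_eq_abs, abs_lt]
    simp only [zcast, Pi.sub_apply]
    constructor <;> linarith
  · refine (measure_biUnion_null_iff (to_countable _)).2 fun γ hγ => ?_
    have hγ0 : γ ≠ 0 := by
      rintro rfl
      rw [mem_ofPred_eq, zcast_zero, zero_sub, norm_neg] at hγ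
      exact lt_asymm hγ hsv
    have := hnone γ hγ0 (s • v) (θ.submodule.smul_mem s hv) (hγ.trans_le (min_le_left _ _))
    rw [indMeasure, Measure.prod_prod, nonpos_iff_eq_zero.1 this, mul_zero]

end

/-- a line is a recurrent direction for a measure preserving `ℤ^d`-action `T` iff it
is a recurrent direction for the induced `ℝ^d`-action `T̃` on `[0,1)^d × X`. -/
theorem recurrent_directions_eq_induced {X : Type*} [MeasurableSpace X] [StandardBorelSpace X]
    (μ : Measure X) [SigmaFinite μ] {d : ℕ} (hd : 1 ≤ d)
    (T : (Fin d → ℤ) → X ≃ᵐ X) (hT : IsMPAction μ T)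
    (θ : Projectivization ℝ (Fin d → ℝ)) :
    RecurrentAlong μ T θ ↔ ActionRecurrentAlong (indMeasure μ) (indMap T) θ :=
  ⟨actionRecurrentAlong_of_recurrentAlong hT, recurrentAlong_of_actionRecurrentAlong⟩
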